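/- arXiv:2001.00696 — 2 statements merged into one kernel-verified Lean document; each statement's English description precedes it below -/
import Mathlib

section
/- A Banach space X is HLUR if and only if X is locally U-convex, satisfies the property (HS), and for every x ∈ S_X the face S(X,x*,0) is the same for all x* ∈ J(x). -/
open Metric Filter Topology NormedSpace

noncomputable section

/-- The face `S(X, f, 0) = {y ∈ B_X : f(y) = 1}` determined by a functional `f`. -/
def face (X : Type*) [NormedAddCommGroup X] [NormedSpace ℝ X] (f : X →L[ℝ] ℝ) : Set X :=
  {y | ‖y‖ ≤ 1 ∧ f y = 1}

/-- Property (HS). -/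
def HSProp (X : Type*) [NormedAddCommGroup X] [NormedSpace ℝ X] : Prop :=
  ∀ f : X →L[ℝ] ℝ, ‖f‖ = 1 → (face X f).Nonempty →
    ∀ xs : ℕ → X, (∀ n, ‖xs n‖ ≤ 1) →
      Tendsto (fun n => f (xs n)) atTop (𝓝 1) →
      Tendsto (fun n => infDist (xs n) (face X f)) atTop (𝓝 0)

/-- Property (HLUR). -/
def HLUR (X : Type*) [NormedAddCommGroup X] [NormedSpace ℝ X] : Prop :=
  ∀ x : X, ‖x‖ = 1 → ∀ xs : ℕ → X, (∀ n, ‖xs n‖ = 1) →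
    Tendsto (fun n => ‖xs n + x‖) atTop (𝓝 2) →
    ∀ f : X →L[ℝ] ℝ, ‖f‖ = 1 → f x = 1 →
      Tendsto (fun n => infDist (xs n) (face X f)) atTop (𝓝 0)

/-- Local uniform rotundity. -/
def LUR (X : Type*) [NormedAddCommGroup X] [NormedSpace ℝ X] : Prop :=
  ∀ x : X, ‖x‖ = 1 → ∀ xs : ℕ → X, (∀ n, ‖xs n‖ = 1) →
    Tendsto (fun n => ‖xs n + x‖) atTop (𝓝 2) → Tendsto xs atTop (𝓝 x)

/-- Compact local uniform rotundity. -/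
def CLUR (X : Type*) [NormedAddCommGroup X] [NormedSpace ℝ X] : Prop :=
  ∀ x : X, ‖x‖ = 1 → ∀ xs : ℕ → X, (∀ n, ‖xs n‖ = 1) →
    Tendsto (fun n => ‖xs n + x‖) atTop (𝓝 2) →
    ∃ φ : ℕ → ℕ, StrictMono φ ∧ ∃ z : X, Tendsto (xs ∘ φ) atTop (𝓝 z)

/-- Local U-convexity. -/
def LocallyUConvex (X : Type*) [NormedAddCommGroup X] [NormedSpace ℝ X] : Prop :=
  ∀ x : X, ‖x‖ = 1 → ∀ xs : ℕ → X, (∀ n, ‖xs n‖ = 1) →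
    Tendsto (fun n => ‖xs n + x‖) atTop (𝓝 2) →
    ∃ f : X →L[ℝ] ℝ, ‖f‖ = 1 ∧ f x = 1 ∧ Tendsto (fun n => f (xs n)) atTop (𝓝 1)

/-- Strong local U-convexity. -/
def StronglyLocallyUConvex (X : Type*) [NormedAddCommGroup X] [NormedSpace ℝ X] : Prop :=
  ∀ x : X, ‖x‖ = 1 → ∀ xs : ℕ → X, (∀ n, ‖xs n‖ = 1) →
    Tendsto (fun n => ‖xs n + x‖) atTop (𝓝 2) →
    ∀ f : X →L[ℝ] ℝ, ‖f‖ = 1 → f x = 1 → Tendsto (fun n => f (xs n)) atTop (𝓝 1)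

/-- Rotundity (strict convexity): every face has at most one element. -/
def Rotund (X : Type*) [NormedAddCommGroup X] [NormedSpace ℝ X] : Prop :=
  ∀ f : X →L[ℝ] ℝ, ‖f‖ = 1 → (face X f).Subsingleton

/-- Near strict convexity: every face is norm-compact. -/
def NSC (X : Type*) [NormedAddCommGroup X] [NormedSpace ℝ X] : Prop :=
  ∀ f : X →L[ℝ] ℝ, ‖f‖ = 1 → IsCompact (face X f)

/-- Kadets-Klee property. -/
def KadetsKlee (X : Type*) [NormedAddCommGroup X] [NormedSpace ℝ X] : Prop :=
  ∀ (xs : ℕ → X) (x : X),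
    (∀ f : X →L[ℝ] ℝ, Tendsto (fun n => f (xs n)) atTop (𝓝 (f x))) →
    Tendsto (fun n => ‖xs n‖) atTop (𝓝 ‖x‖) → Tendsto xs atTop (𝓝 x)

/-- Alternatively convex or smooth. -/
def ACS (X : Type*) [NormedAddCommGroup X] [NormedSpace ℝ X] : Prop :=
  ∀ x y : X, ‖x‖ = 1 → ‖y‖ = 1 → ∀ f : X →L[ℝ] ℝ, ‖f‖ = 1 →
    ‖x + y‖ = 2 → f x = 1 → f y = 1

/-- Smoothness: each unit vector has a unique norming functional. -/
def SmoothSpace (X : Type*) [NormedAddCommGroup X] [NormedSpace ℝ X] : Prop :=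
  ∀ x : X, ‖x‖ = 1 → ∃! f : X →L[ℝ] ℝ, ‖f‖ = 1 ∧ f x = 1

/-- Reflexivity of a normed space. -/
def ReflexiveSpace (X : Type*) [NormedAddCommGroup X] [NormedSpace ℝ X] : Prop :=
  Function.Surjective (inclusionInDoubleDual ℝ X)

/-- Strong rotundity: reflexive, rotund and Kadets-Klee. -/
def StronglyRotund (X : Type*) [NormedAddCommGroup X] [NormedSpace ℝ X] : Prop :=
  ReflexiveSpace X ∧ Rotund X ∧ KadetsKlee X

theorem apply_le_one_aux {X : Type*} [NormedAddCommGroup X] [NormedSpace ℝ X] (f : X →L[ℝ] ℝ)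
    (hf : ‖f‖ = 1) (y : X) : |f y| ≤ ‖y‖ := by
  have := f.le_opNorm y
  rwa [hf, one_mul, Real.norm_eq_abs] at this

theorem abs_le_infDist_aux {X : Type*} [NormedAddCommGroup X] [NormedSpace ℝ X] (f : X →L[ℝ] ℝ)
    (hf : ‖f‖ = 1) (x : X) (hx : x ∈ face X f) (y : X) :
    |f y - 1| ≤ infDist y (face X f) := by
  rw [le_infDist ⟨x, hx⟩]
  intro z hz
  have := apply_le_one_aux f hf (y - z)
  rwa [map_sub, hz.2, ← dist_eq_norm] at this

theorem hlur_apply_aux {X : Type*} [NormedAddCommGroup X] [NormedSpace ℝ X] (h : HLUR X)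
    (x : X) (hx : ‖x‖ = 1) (xs : ℕ → X) (hxs : ∀ n, ‖xs n‖ = 1)
    (ht : Tendsto (fun n => ‖xs n + x‖) atTop (𝓝 2)) (f : X →L[ℝ] ℝ) (hf : ‖f‖ = 1)
    (hfx : f x = 1) : Tendsto (fun n => f (xs n)) atTop (𝓝 1) := by
  rw [tendsto_iff_dist_tendsto_zero]
  exact squeeze_zero (fun _ => dist_nonneg)
    (fun n => abs_le_infDist_aux f hf x ⟨hx.le, hfx⟩ (xs n)) (h x hx xs hxs ht f hf hfx)

theorem face_norm_aux {X : Type*} [NormedAddCommGroup X] [NormedSpace ℝ X] (f : X →L[ℝ] ℝ)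
    (hf : ‖f‖ = 1) (x : X) (hx : x ∈ face X f) : ‖x‖ = 1 := by
  have := apply_le_one_aux f hf x
  rw [hx.2, abs_one] at this
  exact le_antisymm hx.1 this

theorem face_sub_aux {X : Type*} [NormedAddCommGroup X] [NormedSpace ℝ X] (h : HLUR X)
    (x : X) (hx : ‖x‖ = 1) (f g : X →L[ℝ] ℝ) (hf : ‖f‖ = 1) (hfx : f x = 1) (hg : ‖g‖ = 1)
    (hgx : g x = 1) : face X f ⊆ face X g := by
  intro y hy
  have hy1 := face_norm_aux f hf y hy
  have h2 : ‖y + x‖ = 2 := by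
    have h3 := (le_abs_self _).trans (apply_le_one_aux f hf (y + x))
    have h4 := norm_add_le y x
    rw [map_add, hy.2, hfx] at h3
    linarith
  have := hlur_apply_aux h x hx (fun _ => y) (fun _ => hy1)
    (by simp only [h2]; exact tendsto_const_nhds) g hg hgx
  exact ⟨hy.1, tendsto_nhds_unique tendsto_const_nhds this⟩

theorem hs_aux {X : Type*} [NormedAddCommGroup X] [NormedSpace ℝ X] (h : HLUR X) :
    HSProp X := by
  rintro f hf ⟨x, hxf⟩ xs hxs ht
  have hx := face_norm_aux f hf x hxf
  have key : ∀ n, ∃ y : X, ‖y‖ = 1 ∧ ‖y - xs n‖ ≤ 1 - f (xs n) := by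
    intro n
    have h1 := (le_abs_self _).trans (apply_le_one_aux f hf (xs n))
    by_cases h0 : xs n = 0
    · exact ⟨x, hx, by simp [h0, hx]⟩
    · have hp : 0 < ‖xs n‖ := norm_pos_iff.2 h0
      refine ⟨‖xs n‖⁻¹ • xs n, by rw [norm_smul, norm_inv, norm_norm, inv_mul_cancel₀ hp.ne'], ?_⟩
      have e : ‖xs n‖⁻¹ • xs n - xs n = (‖xs n‖⁻¹ - 1) • xs n := by rw [sub_smul, one_smul]
      have h2 : 0 ≤ ‖xs n‖⁻¹ - 1 := by
        have := (one_le_inv₀ hp).2 (hxs n)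
        linarith
      rw [e, norm_smul, Real.norm_of_nonneg h2, sub_mul, inv_mul_cancel₀ hp.ne']
      linarith
  choose y hy1 hy2 using key
  have hlim : Tendsto (fun n => 1 - f (xs n)) atTop (𝓝 0) := by
    simpa using ht.const_sub 1
  have h2 : Tendsto (fun n => ‖y n + x‖) atTop (𝓝 2) := by
    have hl : Tendsto (fun n => 2 * f (xs n)) atTop (𝓝 2) := by simpa using ht.const_mul 2
    refine tendsto_of_tendsto_of_tendsto_of_le_of_le hl tendsto_const_nhds ?_ ?_
    · intro n
      have h3 := (le_abs_self _).trans (apply_le_one_aux f hf (y n + x))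
      have h4 := (neg_le_abs _).trans (apply_le_one_aux f hf (y n - xs n))
      rw [map_add, hxf.2] at h3
      rw [map_sub] at h4
      have := hy2 n
      show 2 * f (xs n) ≤ ‖y n + x‖
      linarith
    · intro n
      have := norm_add_le (y n) x
      rw [hy1, hx] at this
      show ‖y n + x‖ ≤ 2
      linarith
  have h5 := h x hx y hy1 h2 f hf hxf.2
  refine squeeze_zero (fun _ => infDist_nonneg) (fun n => ?_) (by simpa using h5.add hlim)
  have := infDist_le_infDist_add_dist (s := face X f) (x := xs n) (y := y n)
  rw [dist_comm, dist_eq_norm] at this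
  linarith [hy2 n]

theorem hlur_iff_luc_hs_faces (X : Type*) [NormedAddCommGroup X] [NormedSpace ℝ X]
    [CompleteSpace X] :
    HLUR X ↔ LocallyUConvex X ∧ HSProp X ∧
      (∀ x : X, ‖x‖ = 1 → ∀ f g : X →L[ℝ] ℝ, ‖f‖ = 1 → f x = 1 → ‖g‖ = 1 → g x = 1 →
        face X f = face X g) := by
  constructor
  · intro h
    refine ⟨?_, hs_aux h, ?_⟩
    · intro x hx xs hxs ht
      obtain ⟨f, hf, hfx⟩ := exists_dual_vector ℝ x (by rw [← norm_ne_zero_iff, hx]; norm_num)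
      have hfx' : f x = 1 := by rw [hfx, hx]; simp
      exact ⟨f, hf, hfx', hlur_apply_aux h x hx xs hxs ht f hf hfx'⟩
    · intro x hx f g hf hfx hg hgx
      exact (face_sub_aux h x hx f g hf hfx hg hgx).antisymm
        (face_sub_aux h x hx g f hg hgx hf hfx)
  · rintro ⟨hl, hs, hfc⟩ x hx xs hxs ht f hf hfx
    obtain ⟨g, hg, hgx, hgt⟩ := hl x hx xs hxs ht
    rw [hfc x hx f g hf hfx hg hgx]
    exact hs g hg ⟨x, hx.le, hgx⟩ xs (fun n => (hxs n).le) hgt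
end
end

section
/- A Banach space X is LUR if and only if X is rotund, locally U-convex, and satisfies the property (HS). -/
open Metric Filter Topology NormedSpace

noncomputable section

theorem lur_iff_rotund_luc_hs (X : Type*) [NormedAddCommGroup X] [NormedSpace ℝ X]
    [CompleteSpace X] :
    LUR X ↔ Rotund X ∧ LocallyUConvex X ∧ HSProp X := by
  have key : ∀ f : X →L[ℝ] ℝ, ‖f‖ = 1 → ∀ y : X, f y ≤ ‖y‖ := by
    intro f hf y
    have h := f.le_opNorm y
    rw [hf, one_mul] at h
    exact (le_abs_self _).trans h
  have knorm : ∀ f : X →L[ℝ] ℝ, ‖f‖ = 1 → ∀ y ∈ face X f, ‖y‖ = 1 := by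
    intro f hf y hy
    have h := key f hf y
    rw [hy.2] at h
    exact le_antisymm hy.1 h
  constructor
  · intro hL
    refine ⟨?_, ?_, ?_⟩
    · intro f hf y hy z hz
      have h1 : ‖y + z‖ = 2 := by
        apply le_antisymm
        · have := norm_add_le y z
          linarith [hy.1, hz.1]
        · have := key f hf (y + z)
          rw [map_add, hy.2, hz.2] at this
          linarith
      have h := hL z (knorm f hf z hz) (fun _ => y) (fun _ => knorm f hf y hy)
        (by simp only [h1]; exact tendsto_const_nhds)
      exact tendsto_nhds_unique tendsto_const_nhds h
    · intro x hx xs hxs h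
      obtain ⟨f, hf, hfx⟩ := exists_dual_vector ℝ x (by intro h0; simp [h0] at hx)
      have hfx1 : f x = 1 := by simpa [hx] using hfx
      refine ⟨f, hf, hfx1, ?_⟩
      have := (f.continuous.tendsto x).comp (hL x hx xs hxs h)
      rwa [hfx1] at this
    · intro f hf hne xs hxs h
      obtain ⟨y, hy⟩ := hne
      have hy1 := knorm f hf y hy
      classical
      let ys : ℕ → X := fun n => if xs n = 0 then y else ‖xs n‖⁻¹ • xs n
      have hys : ∀ n, ‖ys n‖ = 1 := by
        intro n
        by_cases h0 : xs n = 0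
        · simp [ys, h0, hy1]
        · simp [ys, h0, norm_smul]
      have hxy : ∀ n, xs n = ‖xs n‖ • ys n := by
        intro n
        by_cases h0 : xs n = 0
        · simp [h0]
        · simp [ys, h0, smul_smul]
      have hnx : Tendsto (fun n => ‖xs n‖) atTop (𝓝 1) :=
        tendsto_of_tendsto_of_tendsto_of_le_of_le h tendsto_const_nhds
          (fun n => key f hf (xs n)) hxs
      have hsum : Tendsto (fun n => ‖ys n + y‖) atTop (𝓝 2) := by
        have h2 : Tendsto (fun n => f (xs n) + 1) atTop (𝓝 2) := by
          have := h.add_const 1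
          norm_num at this
          exact this
        refine tendsto_of_tendsto_of_tendsto_of_le_of_le' h2 tendsto_const_nhds ?_ ?_
        · filter_upwards [h.eventually (lt_mem_nhds (zero_lt_one))] with n hn
          have h3 := key f hf (ys n + y)
          rw [map_add, hy.2] at h3
          have h4 : f (xs n) = ‖xs n‖ * f (ys n) := by
            conv_lhs => rw [hxy n]
            simp
          have h5 : 0 < f (ys n) := by
            rw [h4] at hn
            exact pos_of_mul_pos_right hn (norm_nonneg _)
          nlinarith [hxs n]
        · refine Eventually.of_forall fun n => ?_
          have := norm_add_le (ys n) y
          rw [hys n, hy1] at this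
          linarith
      have hlim := hnx.smul (hL y hy1 ys hys hsum)
      rw [one_smul] at hlim
      have hlim2 : Tendsto xs atTop (𝓝 y) := hlim.congr fun n => (hxy n).symm
      exact squeeze_zero (fun n => infDist_nonneg) (fun n => infDist_le_dist_of_mem hy)
        (tendsto_iff_dist_tendsto_zero.1 hlim2)
  · rintro ⟨hR, hU, hH⟩ x hx xs hxs h
    obtain ⟨f, hf, hfx, hlim⟩ := hU x hx xs hxs h
    have hxf : x ∈ face X f := ⟨hx.le, hfx⟩
    have hface : face X f = {x} := (hR f hf).eq_singleton_of_mem hxf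
    have h2 := hH f hf ⟨x, hxf⟩ xs (fun n => (hxs n).le) hlim
    simp only [hface, infDist_singleton] at h2
    exact tendsto_iff_dist_tendsto_zero.2 h2
end
end
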